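/- Let 𝒪 be the ring of all algebraic integers (the integral closure of ℤ in an algebraic closure of ℚ, or equivalently in ℂ), let n be a natural number, and let Z ⊆ ℕ^n be an 𝒪-exponential-polynomial set. Then there exist natural numbers r and s, pairwise commuting matrices φ_1,…,φ_n ∈ M_{r×r}(ℤ), a vector a ∈ ℤ^r, and a ℤ-linear map L : ℤ^r → ℤ^s such that Z = { (ℓ_1,…,ℓ_n) ∈ ℕ^n : L(φ_1^{ℓ_1}·⋯·φ_n^{ℓ_n}·a) = 0 }. -/

import Mathlib

open Matrix

/-- The ring of all algebraic integers: the integral closure of `ℤ` in an algebraic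
closure of `ℚ`. -/
noncomputable def AlgInt : Type := integralClosure ℤ (AlgebraicClosure ℚ)

noncomputable instance : CommRing AlgInt :=
  inferInstanceAs (CommRing (integralClosure ℤ (AlgebraicClosure ℚ)))

/-- `f : ℕ^n → R` is an `R`-exponential-polynomial function: there are `m`, elements
`α_1, …, α_m ∈ R`, and a polynomial `P` in `n(m+1)` variables over `R` such that
`f ℓ = P(ℓ_1, …, ℓ_n; α_1^{ℓ_1}, …, α_m^{ℓ_1}, …, α_1^{ℓ_n}, …, α_m^{ℓ_n})`. -/
def IsExpPolyFun (R : Type*) [CommRing R] (n : ℕ) (f : (Fin n → ℕ) → R) : Prop :=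
  ∃ (m : ℕ) (α : Fin m → R) (P : MvPolynomial (Fin n ⊕ Fin n × Fin m) R),
    ∀ ℓ : Fin n → ℕ,
      f ℓ = MvPolynomial.eval
        (Sum.elim (fun i => ((ℓ i : ℕ) : R)) (fun p => α p.2 ^ ℓ p.1)) P

/-- `Z ⊆ ℕ^n` is an `R`-exponential-polynomial set: a finite intersection of zero
sets of `R`-exponential-polynomial functions. -/
def IsExpPolySet (R : Type*) [CommRing R] (n : ℕ) (Z : Set (Fin n → ℕ)) : Prop :=
  ∃ (m : ℕ) (f : Fin m → ((Fin n → ℕ) → R)),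
    (∀ i, IsExpPolyFun R n (f i)) ∧ Z = ⋂ i, {ℓ | f i ℓ = 0}

section Helpers

variable {R : Type*} [CommRing R] {n : ℕ}

/-- Translation by `k` on functions `ℕ^n → R`. -/
def shiftAlg (R : Type*) [CommRing R] {n : ℕ} (k : Fin n → ℕ) :
    ((Fin n → ℕ) → R) →ₐ[ℤ] ((Fin n → ℕ) → R) :=
  AlgHom.ofLinearMap (LinearMap.funLeft ℤ R (fun l => l + k)) rfl (fun _ _ => rfl)

theorem shiftAlg_apply (k : Fin n → ℕ) (f : (Fin n → ℕ) → R) (l : Fin n → ℕ) :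
    shiftAlg R k f l = f (l + k) := rfl

/-- `f` lies in a finitely generated translation-stable `ℤ`-module of functions. -/
def IsFinShift (f : (Fin n → ℕ) → R) : Prop :=
  ∃ M : Submodule ℤ ((Fin n → ℕ) → R), M.FG ∧
    (∀ k, ∀ g ∈ M, shiftAlg R k g ∈ M) ∧ f ∈ M

theorem IsFinShift.add {f g : (Fin n → ℕ) → R} (hf : IsFinShift f) (hg : IsFinShift g) :
    IsFinShift (f + g) := by
  obtain ⟨M, hM, sM, fM⟩ := hf
  obtain ⟨N, hN, sN, gN⟩ := hg
  refine ⟨M ⊔ N, hM.sup hN, ?_, Submodule.add_mem_sup fM gN⟩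
  intro k x hx
  obtain ⟨y, hy, z, hz, rfl⟩ := Submodule.mem_sup.1 hx
  rw [map_add]
  exact Submodule.add_mem_sup (sM k y hy) (sN k z hz)

theorem IsFinShift.mul {f g : (Fin n → ℕ) → R} (hf : IsFinShift f) (hg : IsFinShift g) :
    IsFinShift (f * g) := by
  obtain ⟨M, hM, sM, fM⟩ := hf
  obtain ⟨N, hN, sN, gN⟩ := hg
  refine ⟨M * N, hM.mul hN, ?_, Submodule.mul_mem_mul fM gN⟩
  intro k x hx
  induction hx using Submodule.mul_induction_on' with
  | mem_mul_mem y hy z hz =>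
    rw [map_mul]
    exact Submodule.mul_mem_mul (sM k y hy) (sN k z hz)
  | add y _ z _ hy hz =>
    rw [map_add]
    exact add_mem hy hz

theorem isFinShift_const (c : R) : IsFinShift (fun _ : Fin n → ℕ => c) := by
  refine ⟨Submodule.span ℤ {fun _ => c}, Submodule.fg_span_singleton _, ?_,
    Submodule.mem_span_singleton_self _⟩
  intro k g hg
  obtain ⟨z, rfl⟩ := Submodule.mem_span_singleton.1 hg
  rw [map_smul]
  exact Submodule.smul_mem _ _ (Submodule.mem_span_singleton_self _)

theorem isFinShift_coord (i : Fin n) :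
    IsFinShift (fun l : Fin n → ℕ => ((l i : ℕ) : R)) := by
  refine ⟨Submodule.span ℤ {(fun l => ((l i : ℕ) : R)), 1},
    Submodule.fg_span (by simp), ?_, Submodule.subset_span (by simp)⟩
  intro k g hg
  obtain ⟨y, z, rfl⟩ := Submodule.mem_span_pair.1 hg
  refine Submodule.mem_span_pair.2 ⟨y, y * k i + z, ?_⟩
  funext l
  simp [shiftAlg_apply]
  ring

theorem isFinShift_pow {α : R} (hα : IsIntegral ℤ α) (i : Fin n) :
    IsFinShift (fun l : Fin n → ℕ => α ^ l i) := by
  let T : R →ₗ[ℤ] ((Fin n → ℕ) → R) := LinearMap.pi fun l => LinearMap.mulRight ℤ (α ^ l i)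
  refine ⟨(Subalgebra.toSubmodule (Algebra.adjoin ℤ {α})).map T,
    hα.fg_adjoin_singleton.map T, ?_, ⟨1, one_mem (Algebra.adjoin ℤ {α}), ?_⟩⟩
  · rintro k _ ⟨c, hc, rfl⟩
    refine ⟨c * α ^ k i, mul_mem (S := Subalgebra ℤ R) hc
      (pow_mem (Algebra.self_mem_adjoin_singleton ℤ α) _), ?_⟩
    funext l
    simp [shiftAlg_apply, T, pow_add]
    ring
  · funext l
    simp [T]

theorem IsExpPolyFun.isFinShift (hR : ∀ α : R, IsIntegral ℤ α) {f : (Fin n → ℕ) → R}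
    (hf : IsExpPolyFun R n f) : IsFinShift f := by
  obtain ⟨m, α, P, h⟩ := hf
  obtain rfl : f = _ := funext h
  clear h
  induction P using MvPolynomial.induction_on with
  | C a => simpa using isFinShift_const a
  | add p q hp hq => simpa [Pi.add_def] using hp.add hq
  | mul_X p x hp =>
    have hx : IsFinShift (fun l : Fin n → ℕ => (Sum.elim (fun i => ((l i : ℕ) : R))
        (fun p : Fin n × Fin m => α p.2 ^ l p.1) x)) := by
      rcases x with i | ⟨i, j⟩
      · exact isFinShift_coord i
      · exact isFinShift_pow (hR _) i
    simpa [Pi.mul_def] using hp.mul hx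

/-- A finite-rank return set can be written with integer matrices. -/
theorem exists_matrices {M W : Type*} [AddCommGroup M] [Module.Finite ℤ M]
    [Module.IsTorsionFree ℤ M] [AddCommGroup W] [Module.IsTorsionFree ℤ W]
    (ρ : Multiplicative (Fin n → ℕ) →* Module.End ℤ M) (f : M) (ev : M →ₗ[ℤ] W) :
    ∃ (r s : ℕ) (φ : Fin n → Matrix (Fin r) (Fin r) ℤ) (a : Fin r → ℤ)
      (L : (Fin r → ℤ) →ₗ[ℤ] (Fin s → ℤ)),
      (∀ i i', φ i * φ i' = φ i' * φ i) ∧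
      {ℓ | ev (ρ (Multiplicative.ofAdd ℓ) f) = 0} =
        {ℓ | L ((List.ofFn fun i => φ i ^ ℓ i).prod *ᵥ a) = 0} := by
  let b := Module.finBasis ℤ M
  let c := Module.finBasis ℤ (LinearMap.range ev)
  let e := LinearMap.toMatrixAlgEquiv b
  refine ⟨_, _, fun i => e (ρ (Multiplicative.ofAdd (Pi.single i 1))), b.equivFun f,
    c.equivFun.toLinearMap ∘ₗ ev.rangeRestrict ∘ₗ b.equivFun.symm.toLinearMap, ?_, ?_⟩
  · intro i i'
    rw [← map_mul e, ← map_mul e, ← map_mul ρ, ← map_mul ρ, mul_comm]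
  · ext ℓ
    have h1 : (List.ofFn fun i => e (ρ (Multiplicative.ofAdd (Pi.single i 1))) ^ ℓ i).prod
        = e (ρ (Multiplicative.ofAdd ℓ)) := by
      have : (fun i => e (ρ (Multiplicative.ofAdd (Pi.single i 1))) ^ ℓ i)
          = (fun x => e (ρ x)) ∘ fun i => (Multiplicative.ofAdd (Pi.single i (ℓ i))) := by
        funext i
        simp only [Function.comp]
        rw [← map_pow, ← map_pow, ← ofAdd_nsmul, ← Pi.single_smul]
        simp
      rw [this, ← List.map_ofFn]
      have h2 := map_list_prod ((MonoidHomClass.toMonoidHom e).comp ρ)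
        (List.ofFn fun i => (Multiplicative.ofAdd (Pi.single i (ℓ i))))
      refine h2.symm.trans ?_
      rw [List.prod_ofFn, ← ofAdd_sum, Finset.univ_sum_single]
      rfl
    have h3 : e (ρ (Multiplicative.ofAdd ℓ)) *ᵥ b.equivFun f
        = b.equivFun (ρ (Multiplicative.ofAdd ℓ) f) :=
      LinearMap.toMatrix_mulVec_repr b b _ f
    simp only [Set.mem_ofPred_eq]
    rw [h1, h3]
    simp only [LinearMap.comp_apply, LinearEquiv.coe_coe, LinearEquiv.symm_apply_apply,
      LinearEquiv.map_eq_zero_iff]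
    rw [Subtype.ext_iff]
    rfl

theorem expPolySet_return [IsDomain R] [CharZero R] (hR : ∀ α : R, IsIntegral ℤ α)
    (Z : Set (Fin n → ℕ)) (hZ : IsExpPolySet R n Z) :
    ∃ (r s : ℕ) (φ : Fin n → Matrix (Fin r) (Fin r) ℤ) (a : Fin r → ℤ)
      (L : (Fin r → ℤ) →ₗ[ℤ] (Fin s → ℤ)),
      (∀ i i', φ i * φ i' = φ i' * φ i) ∧
      Z = {ℓ | L ((List.ofFn fun i => φ i ^ ℓ i).prod *ᵥ a) = 0} := by
  obtain ⟨m, f, hf, rfl⟩ := hZ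
  choose M hM sM fM using fun j => (hf j).isFinShift hR
  have hfin : ∀ j, Module.Finite ℤ (M j) := fun j => Module.Finite.iff_fg.2 (hM j)
  let ρ : Multiplicative (Fin n → ℕ) →* Module.End ℤ (∀ j, M j) :=
    { toFun := fun k => LinearMap.pi fun j =>
        ((shiftAlg R k.toAdd).toLinearMap.restrict (sM j k.toAdd)) ∘ₗ LinearMap.proj j
      map_one' := by
        ext g j l
        simp [shiftAlg_apply]
      map_mul' := by
        intro x y
        refine LinearMap.ext fun g => funext fun j => Subtype.ext (funext fun l => ?_)
        change (g j).1 (l + (x.toAdd + y.toAdd)) = (g j).1 (l + x.toAdd + y.toAdd)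
        rw [add_assoc] }
  let ev : (∀ j, M j) →ₗ[ℤ] (Fin m → R) :=
    LinearMap.pi fun j => LinearMap.proj (0 : Fin n → ℕ) ∘ₗ (M j).subtype ∘ₗ LinearMap.proj j
  obtain ⟨r, s, φ, a, L, hc, h⟩ := exists_matrices ρ (fun j => ⟨f j, fM j⟩) ev
  refine ⟨r, s, φ, a, L, hc, ?_⟩
  rw [← h]
  ext ℓ
  rw [Set.mem_iInter, Set.mem_ofPred_eq, funext_iff]
  refine forall_congr' fun j => ?_
  change f j ℓ = 0 ↔ f j (0 + ℓ) = 0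
  rw [zero_add]

end Helpers

/-- Every exponential-polynomial set over the ring of all algebraic integers is the
return set of a linear dynamical system over `ℤ`: there are commuting integer matrices
`φ_1, …, φ_n`, a vector `a ∈ ℤ^r` and a `ℤ`-linear map `L : ℤ^r → ℤ^s` with
`Z = {ℓ ∈ ℕ^n : L(φ_1^{ℓ_1} ⋯ φ_n^{ℓ_n} a) = 0}`. -/
theorem algInt_expPolySet_is_integer_linear_return_set
    (n : ℕ) (Z : Set (Fin n → ℕ)) (hZ : IsExpPolySet AlgInt n Z) :
    ∃ (r s : ℕ) (φ : Fin n → Matrix (Fin r) (Fin r) ℤ) (a : Fin r → ℤ)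
      (L : (Fin r → ℤ) →ₗ[ℤ] (Fin s → ℤ)),
      (∀ i i', φ i * φ i' = φ i' * φ i) ∧
      Z = {ℓ | L ((List.ofFn fun i => φ i ^ ℓ i).prod *ᵥ a) = 0} := by
  have : IsDomain AlgInt := inferInstanceAs (IsDomain (integralClosure ℤ (AlgebraicClosure ℚ)))
  have : CharZero AlgInt := inferInstanceAs (CharZero (integralClosure ℤ (AlgebraicClosure ℚ)))
  refine expPolySet_return (fun α => ?_) Z hZ
  have h : IsIntegral ℤ (show integralClosure ℤ (AlgebraicClosure ℚ) from α) :=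
    integralClosure.isIntegral _
  obtain ⟨p, hp, h0⟩ := h
  refine ⟨p, hp, ?_⟩
  have e : algebraMap ℤ AlgInt = algebraMap ℤ (integralClosure ℤ (AlgebraicClosure ℚ)) :=
    RingHom.ext_int _ _
  rw [e]
  exact h0
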